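/- arXiv:2204.08821 — 2 statements merged into one kernel-verified Lean document; each statement's English description precedes it below -/
import Mathlib

section
/- Let α > β > 0 with α² + β² = 1, let φ₁ = α|00⟩ + β|11⟩ and φ₂ = β|00⟩ − α|11⟩, and let 0 < p < 1. The concurrence of the two-qubit density matrix ρ = p|φ₁⟩⟨φ₁| + (1−p)|φ₂⟩⟨φ₂| equals 2αβ|1 − 2p|. -/
open Matrix BigOperators ComplexOrder Kronecker Polynomial

/-- The Pauli matrix `σ_y`. -/
def pauliY : Matrix (Fin 2) (Fin 2) ℂ := !![0, -Complex.I; Complex.I, 0]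

/-- The matrix `ρ (σ_y ⊗ σ_y) ρ̄ (σ_y ⊗ σ_y)` entering the definition of the
concurrence, where `ρ̄` is the entrywise complex conjugate of `ρ`. -/
noncomputable def concMat (ρ : Matrix (Fin 2 × Fin 2) (Fin 2 × Fin 2) ℂ) :
    Matrix (Fin 2 × Fin 2) (Fin 2 × Fin 2) ℂ :=
  ρ * (pauliY ⊗ₖ pauliY) * (ρ.map (starRingEnd ℂ)) * (pauliY ⊗ₖ pauliY)

/-- `l` lists, in decreasing order, the nonnegative square roots of the
eigenvalues (with multiplicity, all real and nonnegative) of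
`ρ (σ_y ⊗ σ_y) ρ̄ (σ_y ⊗ σ_y)`: the characteristic polynomial of that matrix is
`∏ i (X − l i ^ 2)`. The concurrence of `ρ` is then
`max 0 (l 0 − l 1 − l 2 − l 3)`. -/
noncomputable def ConcurrenceSpectrum (ρ : Matrix (Fin 2 × Fin 2) (Fin 2 × Fin 2) ℂ)
    (l : Fin 4 → ℝ) : Prop :=
  (∀ i, 0 ≤ l i) ∧ (∀ i j : Fin 4, i ≤ j → l j ≤ l i) ∧
    (concMat ρ).charpoly = ∏ i : Fin 4, (X - C ((l i : ℂ) ^ 2))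

/-- `Φ⁺ = (|00⟩ + |11⟩)/√2`. -/
noncomputable def Φplus : Fin 2 × Fin 2 → ℂ := fun q =>
  if q = (0, 0) then (Real.sqrt 2 : ℂ)⁻¹ else if q = (1, 1) then (Real.sqrt 2 : ℂ)⁻¹ else 0

/-- `Φ⁻ = (|00⟩ − |11⟩)/√2`. -/
noncomputable def Φminus : Fin 2 × Fin 2 → ℂ := fun q =>
  if q = (0, 0) then (Real.sqrt 2 : ℂ)⁻¹ else if q = (1, 1) then -(Real.sqrt 2 : ℂ)⁻¹ else 0

/-- `φ₁ = α|00⟩ + β|11⟩`. -/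
noncomputable def φ₁ (α β : ℝ) : Fin 2 × Fin 2 → ℂ := fun q =>
  if q = (0, 0) then (α : ℂ) else if q = (1, 1) then (β : ℂ) else 0

/-- `φ₂ = β|00⟩ − α|11⟩`. -/
noncomputable def φ₂ (α β : ℝ) : Fin 2 × Fin 2 → ℂ := fun q =>
  if q = (0, 0) then (β : ℂ) else if q = (1, 1) then -(α : ℂ) else 0

lemma concMat_eval (a c d t : ℂ) (M : Matrix (Fin 2 × Fin 2) (Fin 2 × Fin 2) ℂ)
    (hM : ∀ i j, M i j =
      if i = (0, 0) then (if j = (0, 0) then c ^ 2 + a * d else if j = (1, 1) then 2 * a * c else 0)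
      else if i = (1, 1) then
        (if j = (0, 0) then 2 * c * d else if j = (1, 1) then c ^ 2 + a * d else 0)
      else 0) :
    M.charpoly.eval t = t ^ 2 * ((t - (c ^ 2 + a * d)) ^ 2 - 4 * c ^ 2 * (a * d)) := by
  rw [Matrix.eval_charpoly, ← Matrix.det_reindex_self finProdFinEquiv]
  have : (Matrix.reindex finProdFinEquiv finProdFinEquiv) (Matrix.scalar (Fin 2 × Fin 2) t - M)
      = (!![t - (c ^ 2 + a * d), 0, 0, -(2 * a * c); 0, t, 0, 0; 0, 0, t, 0;
          -(2 * c * d), 0, 0, t - (c ^ 2 + a * d)] : Matrix (Fin 4) (Fin 4) ℂ) := by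
    ext i j
    fin_cases i <;> fin_cases j <;>
      simp [finProdFinEquiv, Fin.divNat, Fin.modNat, Matrix.sub_apply, Matrix.diagonal_apply, hM]
  rw [this]
  simp [Matrix.det_succ_row_zero, Fin.sum_univ_succ, Fin.succAbove]
  ring

lemma concMat_form (α β p : ℝ) (i j : Fin 2 × Fin 2) :
    concMat ((p : ℂ) • vecMulVec (φ₁ α β) (star (φ₁ α β)) +
        ((1 - p : ℝ) : ℂ) • vecMulVec (φ₂ α β) (star (φ₂ α β))) i j =
      let a : ℂ := p * α ^ 2 + (1 - p) * β ^ 2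
      let d : ℂ := p * β ^ 2 + (1 - p) * α ^ 2
      let c : ℂ := (2 * p - 1) * α * β
      if i = (0, 0) then (if j = (0, 0) then c ^ 2 + a * d else if j = (1, 1) then 2 * a * c else 0)
      else if i = (1, 1) then
        (if j = (0, 0) then 2 * c * d else if j = (1, 1) then c ^ 2 + a * d else 0)
      else 0 := by
  obtain ⟨i1, i2⟩ := i
  obtain ⟨j1, j2⟩ := j
  fin_cases i1 <;> fin_cases i2 <;> fin_cases j1 <;> fin_cases j2 <;>
    simp [concMat, Matrix.mul_apply, Fintype.sum_prod_type, pauliY, vecMulVec_apply, φ₁, φ₂] <;>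
    ring

/-- The concurrence of `p|φ₁⟩⟨φ₁| + (1−p)|φ₂⟩⟨φ₂|` is `2αβ|1 − 2p|`. -/
theorem concurrence_phi_mixture (α β : ℝ) (hβ : 0 < β) (hαβ : β < α)
    (hαβ1 : α ^ 2 + β ^ 2 = 1) (p : ℝ) (h1 : 0 < p) (h2 : p < 1)
    (l : Fin 4 → ℝ)
    (hl : ConcurrenceSpectrum
      ((p : ℂ) • vecMulVec (φ₁ α β) (star (φ₁ α β)) +
        ((1 - p : ℝ) : ℂ) • vecMulVec (φ₂ α β) (star (φ₂ α β))) l) :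
    max 0 (l 0 - l 1 - l 2 - l 3) = 2 * α * β * |1 - 2 * p| := by
  obtain ⟨h0, hm, hc⟩ := hl
  have key : ∀ t : ℝ, t ^ 2 * ((t - (((2 * p - 1) * α * β) ^ 2 + (p * α ^ 2 + (1 - p) * β ^ 2) *
      (p * β ^ 2 + (1 - p) * α ^ 2))) ^ 2 - 4 * ((2 * p - 1) * α * β) ^ 2 *
      ((p * α ^ 2 + (1 - p) * β ^ 2) * (p * β ^ 2 + (1 - p) * α ^ 2))) =
      (t - l 0 ^ 2) * (t - l 1 ^ 2) * (t - l 2 ^ 2) * (t - l 3 ^ 2) := by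
    intro t
    have e := concMat_eval _ _ _ (t : ℂ) _ (concMat_form α β p)
    rw [hc] at e
    simp only [Fin.prod_univ_four, Polynomial.eval_mul, Polynomial.eval_sub, Polynomial.eval_X,
      Polynomial.eval_C] at e
    exact_mod_cast e.symm
  have had : (p * α ^ 2 + (1 - p) * β ^ 2) * (p * β ^ 2 + (1 - p) * α ^ 2) =
      p * (1 - p) + ((2 * p - 1) * α * β) ^ 2 := by
    have : β ^ 2 = 1 - α ^ 2 := by linarith
    simp only [mul_pow, this]
    ring
  rw [had] at key
  generalize hcc : (2 * p - 1) * α * β = c at *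
  have hq : 0 ≤ p * (1 - p) := mul_nonneg h1.le (by linarith)
  generalize p * (1 - p) = q at *
  have l3 : l 3 = 0 := by
    have m2 := hm 2 3 (by decide)
    have m1 := hm 1 3 (by decide)
    have m0 := hm 0 3 (by decide)
    have k := key 0
    have : l 0 * l 1 * l 2 * l 3 = 0 := by
      have : (l 0 * l 1 * l 2 * l 3) ^ 2 = 0 := by linarith
      exact pow_eq_zero_iff (two_ne_zero) |>.1 this
    have n := h0 3
    simp only [mul_eq_zero] at this
    rcases this with ((h | h) | h) | h <;> linarith
  rw [l3] at key
  have k1 := key 1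
  have k2 := key (-1)
  have k3 := key 2
  have l2 : l 2 = 0 := by
    have m1 := hm 1 2 (by decide)
    have m0 := hm 0 2 (by decide)
    have : l 0 * l 1 * l 2 = 0 := by
      have : (l 0 * l 1 * l 2) ^ 2 = 0 := by linarith
      exact pow_eq_zero_iff (two_ne_zero) |>.1 this
    have n := h0 2
    simp only [mul_eq_zero] at this
    rcases this with (h | h) | h <;> linarith
  rw [l2] at k1 k2 k3
  have s : l 0 ^ 2 + l 1 ^ 2 = 2 * (2 * c ^ 2 + q) := by linarith
  have pr : (l 0 * l 1) ^ 2 = q ^ 2 := by linarith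
  have pr' : l 0 * l 1 = q := by
    rwa [sq_eq_sq₀ (mul_nonneg (h0 0) (h0 1)) hq] at pr
  have m := hm 0 1 (by decide)
  have f : 2 * α * β * |1 - 2 * p| = 2 * |c| := by
    rw [← hcc, abs_mul, abs_mul, abs_of_pos hβ, abs_of_pos (hβ.trans hαβ), abs_sub_comm]
    ring
  have g : l 0 - l 1 = 2 * |c| := by
    rw [← sq_eq_sq₀ (by linarith) (by positivity), mul_pow, sq_abs]
    linarith
  rw [f, l2, l3, sub_zero, sub_zero, g, max_eq_right (by positivity)]
end

section
/- For every p with 0 < p < 1 and for α > β > 0 with α² + β² = 1, the concurrence of ρ_ψ = p|Φ⁺⟩⟨Φ⁺| + (1−p)|Φ⁻⟩⟨Φ⁻| (with Φ± = (|00⟩ ± |11⟩)/√2) is greater than or equal to the concurrence of ρ_φ = p|φ₁⟩⟨φ₁| + (1−p)|φ₂⟩⟨φ₂| (with φ₁ = α|00⟩ + β|11⟩ and φ₂ = β|00⟩ − α|11⟩). -/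
open Matrix BigOperators ComplexOrder Kronecker Polynomial

def xMat (a c d : ℝ) : Matrix (Fin 2 × Fin 2) (Fin 2 × Fin 2) ℂ := fun q r =>
  if q = (0, 0) then (if r = (0, 0) then (a : ℂ) else if r = (1, 1) then (c : ℂ) else 0)
  else if q = (1, 1) then (if r = (0, 0) then (c : ℂ) else if r = (1, 1) then (d : ℂ) else 0)
  else 0

def cMat (a c d : ℝ) : Matrix (Fin 2 × Fin 2) (Fin 2 × Fin 2) ℂ := fun q r =>
  if q = (0, 0) then (if r = (0, 0) then ((c ^ 2 + a * d : ℝ) : ℂ) else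
    if r = (1, 1) then ((2 * a * c : ℝ) : ℂ) else 0)
  else if q = (1, 1) then (if r = (0, 0) then ((2 * c * d : ℝ) : ℂ) else
    if r = (1, 1) then ((c ^ 2 + a * d : ℝ) : ℂ) else 0)
  else 0

lemma concMat_xMat (a c d : ℝ) : concMat (xMat a c d) = cMat a c d := by
  have hY : (pauliY ⊗ₖ pauliY) = (Matrix.of fun q r => if q = (0, 0) then (if r = (1, 1) then -1 else 0)
      else if q = (1, 1) then (if r = (0, 0) then -1 else 0)
      else if q = (0, 1) then (if r = (1, 0) then 1 else 0)
      else (if r = (0, 1) then 1 else 0) : Matrix (Fin 2 × Fin 2) (Fin 2 × Fin 2) ℂ) := by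
    ext ⟨i, j⟩ ⟨k, l⟩
    fin_cases i <;> fin_cases j <;> fin_cases k <;> fin_cases l <;>
      simp [pauliY, Matrix.kroneckerMap_apply]
  unfold concMat
  rw [hY]
  ext ⟨i, j⟩ ⟨k, l⟩
  simp only [Matrix.mul_apply, Fintype.sum_prod_type, Fin.sum_univ_two, Matrix.map_apply, Matrix.of_apply]
  fin_cases i <;> fin_cases j <;> fin_cases k <;> fin_cases l <;>
    simp [xMat, cMat] <;> ring

lemma charpoly_eval (a c d : ℝ) (x : ℂ) : (concMat (xMat a c d)).charpoly.eval x =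
    x ^ 2 * ((x - (c ^ 2 + a * d)) ^ 2 - 4 * a * d * c ^ 2) := by
  rw [concMat_xMat, Matrix.eval_charpoly]
  rw [← Matrix.det_submatrix_equiv_self (finProdFinEquiv (m := 2) (n := 2)).symm]
  have h : ((scalar (Fin 2 × Fin 2)) x - cMat a c d).submatrix
      (finProdFinEquiv (m := 2) (n := 2)).symm (finProdFinEquiv (m := 2) (n := 2)).symm =
      (!![x - (c ^ 2 + a * d), 0, 0, -(2 * a * c); 0, x, 0, 0; 0, 0, x, 0;
        -(2 * c * d), 0, 0, x - (c ^ 2 + a * d)] : Matrix (Fin 4) (Fin 4) ℂ) := by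
    have e0 : (finProdFinEquiv (m := 2) (n := 2)).symm (0 : Fin 4) = (0, 0) := by decide
    have e1 : (finProdFinEquiv (m := 2) (n := 2)).symm (1 : Fin 4) = (0, 1) := by decide
    have e2 : (finProdFinEquiv (m := 2) (n := 2)).symm (2 : Fin 4) = (1, 0) := by decide
    have e3 : (finProdFinEquiv (m := 2) (n := 2)).symm (3 : Fin 4) = (1, 1) := by decide
    ext i j
    rw [Matrix.submatrix_apply]
    fin_cases i <;> fin_cases j <;>
      simp only [Fin.zero_eta, Fin.mk_one, Fin.reduceFinMk, e0, e1, e2, e3] <;>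
      simp [cMat, Matrix.scalar_apply, Matrix.diagonal_apply]
  rw [h]
  simp [Matrix.det_succ_row_zero, Fin.sum_univ_succ, Fin.succAbove]
  ring

lemma conc_val (a c d : ℝ) (l : Fin 4 → ℝ)
    (hl : ConcurrenceSpectrum (xMat a c d) l) (had : c ^ 2 ≤ a * d) :
    l 0 - l 1 - l 2 - l 3 = 2 * |c| := by
  obtain ⟨hn, hs, hc⟩ := hl
  have key : ∀ x : ℝ, x ^ 2 * ((x - (c ^ 2 + a * d)) ^ 2 - 4 * a * d * c ^ 2) =
      (x - l 0 ^ 2) * (x - l 1 ^ 2) * (x - l 2 ^ 2) * (x - l 3 ^ 2) := by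
    intro x
    have h := charpoly_eval a c d (x : ℂ)
    rw [hc] at h
    simp [Polynomial.eval_prod, Fin.prod_univ_four] at h
    exact_mod_cast h.symm
  have s01 := hs 0 1 (by decide)
  have s12 := hs 1 2 (by decide)
  have s23 := hs 2 3 (by decide)
  have n0 := hn 0
  have n1 := hn 1
  have n2 := hn 2
  have n3 := hn 3
  generalize l 0 = A at *
  generalize l 1 = B at *
  generalize l 2 = D at *
  generalize l 3 = E at *
  have k0 := key 0
  have hE : E = 0 := by
    have : A ^ 2 * B ^ 2 * D ^ 2 * E ^ 2 = 0 := by linarith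
    by_contra hne
    have hEp : 0 < E := lt_of_le_of_ne n3 (Ne.symm hne)
    have : 0 < D := by linarith
    have : 0 < B := by linarith
    have : 0 < A := by linarith
    have : 0 < A ^ 2 * B ^ 2 * D ^ 2 * E ^ 2 := by positivity
    linarith
  subst hE
  have k1 := key 1
  have k2 := key (-1)
  have k3 := key 2
  have hD : D = 0 := by
    have : A ^ 2 * B ^ 2 * D ^ 2 = 0 := by linarith
    by_contra hne
    have : 0 < D := lt_of_le_of_ne n2 (Ne.symm hne)
    have : 0 < B := by linarith
    have : 0 < A := by linarith
    have : 0 < A ^ 2 * B ^ 2 * D ^ 2 := by positivity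
    linarith
  subst hD
  have e1 : A ^ 2 + B ^ 2 = 2 * (c ^ 2 + a * d) := by linarith
  have e2 : (A * B) ^ 2 = (a * d - c ^ 2) ^ 2 := by linarith
  have e3 : A * B = a * d - c ^ 2 := by
    rwa [sq_eq_sq₀ (by positivity) (by linarith)] at e2
  have e4 : (A - B) ^ 2 = (2 * |c|) ^ 2 := by
    rw [mul_pow, sq_abs]; linarith
  rw [sq_eq_sq₀ (by linarith) (by positivity)] at e4
  linarith

/-- The concurrence of `ρ_ψ = p|Φ⁺⟩⟨Φ⁺| + (1−p)|Φ⁻⟩⟨Φ⁻|` is at least that of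
`ρ_φ = p|φ₁⟩⟨φ₁| + (1−p)|φ₂⟩⟨φ₂|`. -/
theorem concurrence_comparison (α β : ℝ) (hβ : 0 < β) (hαβ : β < α)
    (hαβ1 : α ^ 2 + β ^ 2 = 1) (p : ℝ) (h1 : 0 < p) (h2 : p < 1)
    (l m : Fin 4 → ℝ)
    (hl : ConcurrenceSpectrum
      ((p : ℂ) • vecMulVec Φplus (star Φplus) +
        ((1 - p : ℝ) : ℂ) • vecMulVec Φminus (star Φminus)) l)
    (hm : ConcurrenceSpectrum
      ((p : ℂ) • vecMulVec (φ₁ α β) (star (φ₁ α β)) +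
        ((1 - p : ℝ) : ℂ) • vecMulVec (φ₂ α β) (star (φ₂ α β))) m) :
    max 0 (m 0 - m 1 - m 2 - m 3) ≤ max 0 (l 0 - l 1 - l 2 - l 3) := by
  have r1 : ((p : ℂ) • vecMulVec Φplus (star Φplus) +
        ((1 - p : ℝ) : ℂ) • vecMulVec Φminus (star Φminus)) =
        xMat (1 / 2) ((2 * p - 1) / 2) (1 / 2) := by
    have h : ((Real.sqrt 2 : ℂ)⁻¹) * (Real.sqrt 2 : ℂ)⁻¹ = 1 / 2 := by
      rw [← mul_inv, ← Complex.ofReal_mul, Real.mul_self_sqrt (by norm_num)]; norm_num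
    ext ⟨i, j⟩ ⟨k, l⟩
    fin_cases i <;> fin_cases j <;> fin_cases k <;> fin_cases l <;>
      simp [xMat, vecMulVec_apply, Φplus, Φminus, h] <;> ring
  have r2 : ((p : ℂ) • vecMulVec (φ₁ α β) (star (φ₁ α β)) +
        ((1 - p : ℝ) : ℂ) • vecMulVec (φ₂ α β) (star (φ₂ α β))) =
        xMat (p * α ^ 2 + (1 - p) * β ^ 2) ((2 * p - 1) * (α * β))
          (p * β ^ 2 + (1 - p) * α ^ 2) := by
    ext ⟨i, j⟩ ⟨k, l⟩
    fin_cases i <;> fin_cases j <;> fin_cases k <;> fin_cases l <;>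
      simp [xMat, vecMulVec_apply, φ₁, φ₂] <;> ring
  rw [r1] at hl
  rw [r2] at hm
  have hp : 0 < p * (1 - p) := mul_pos h1 (by linarith)
  have cl := conc_val _ _ _ l hl (by nlinarith)
  have cm := conc_val _ _ _ m hm (by
    have : (p * α ^ 2 + (1 - p) * β ^ 2) * (p * β ^ 2 + (1 - p) * α ^ 2)
      - ((2 * p - 1) * (α * β)) ^ 2 = p * (1 - p) * (α ^ 2 + β ^ 2) ^ 2 := by ring
    have : 0 ≤ p * (1 - p) * (α ^ 2 + β ^ 2) ^ 2 := by positivity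
    linarith)
  rw [cl, cm]
  apply max_le_max le_rfl
  have hab : α * β ≤ 1 / 2 := by nlinarith [sq_nonneg (α - β)]
  have hab0 : 0 ≤ α * β := by nlinarith
  rw [abs_mul, abs_div, abs_of_nonneg hab0, abs_of_pos (by norm_num : (0:ℝ) < 2)]
  nlinarith [abs_nonneg (2 * p - 1)]
end
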